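/- The quantity CRB_LB is finite and satisfies the two-sided bound (1 − πλ·c²·γ/(2·W_e))·CRB_LB,W < CRB_LB < CRB_LB,W. -/

import Mathlib

open MeasureTheory Real

lemma aux_K (γ b q : ℝ) (hγ : 0 < γ) (hb : 0 < b) (hq : -1 < q) :
    IntegrableOn (fun r : ℝ => r ^ (-γ - 1 - γ * q) * exp (-(b * r ^ (-γ)))) (Set.Ioi 0) ∧
    ∫ r in Set.Ioi (0 : ℝ), r ^ (-γ - 1 - γ * q) * exp (-(b * r ^ (-γ)))
      = (1 / γ) * (b ^ (-(q + 1)) * Gamma (q + 1)) := by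
  have hne : -γ ≠ 0 := by linarith
  have h1 := integrableOn_rpow_mul_exp_neg_mul_rpow hq one_pos hb
  have h2 := integral_rpow_mul_exp_neg_mul_rpow one_pos hq hb
  rw [← integrableOn_Ioi_comp_rpow_iff' _ hne] at h1
  rw [← integral_comp_rpow_Ioi _ hne] at h2
  have key : ∀ r ∈ Set.Ioi (0 : ℝ), r ^ (-γ - 1 - γ * q) * exp (-(b * r ^ (-γ)))
      = r ^ (-γ - 1) * ((r ^ (-γ)) ^ q * exp (-b * (r ^ (-γ)) ^ (1 : ℝ))) := by
    intro r hr
    have hr : 0 < r := hr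
    rw [← rpow_mul hr.le, rpow_one, ← mul_assoc, ← rpow_add hr]
    congr 2 <;> ring
  constructor
  · refine h1.congr_fun (fun r hr => ?_) measurableSet_Ioi
    rw [key r hr]; rfl
  · rw [setIntegral_congr_fun measurableSet_Ioi key]
    simp only [abs_neg, abs_of_pos hγ, smul_eq_mul, mul_assoc, integral_const_mul] at h2
    rw [eq_comm, one_div, inv_mul_eq_iff_eq_mul₀ hγ.ne', h2]
    simp

lemma aux_lt (f g : ℝ → ℝ) (hf : IntegrableOn f (Set.Ioi 0)) (hg : IntegrableOn g (Set.Ioi 0))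
    (h : ∀ x > 0, f x < g x) : ∫ x in Set.Ioi (0 : ℝ), f x < ∫ x in Set.Ioi (0 : ℝ), g x := by
  rw [← sub_pos, ← integral_sub hg hf]
  refine (setIntegral_pos_iff_support_of_nonneg_ae ?_ (hg.sub hf)).2 ?_
  rotate_left
  · have : Function.support (g - f) ∩ Set.Ioi 0 = Set.Ioi 0 := by
      ext x
      simp only [Set.mem_inter_iff, Function.mem_support, Pi.sub_apply, Set.mem_Ioi, and_iff_right_iff_imp]
      intro hx
      exact (sub_pos.2 (h x hx)).ne'
    rw [this]; simp
  · filter_upwards [ae_restrict_mem measurableSet_Ioi] with x hx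
    exact (sub_pos.2 (h x hx)).le

lemma aux_int (γ b : ℝ) (hγ : 2 < γ) (hb : 0 < b) :
    IntegrableOn (fun r : ℝ => (1 - exp (-(b * r ^ (-γ)))) * r) (Set.Ioi 0) := by
  have hm : Measurable (fun r : ℝ => (1 - exp (-(b * r ^ (-γ)))) * r) := by fun_prop
  rw [← Set.Ioc_union_Ioi_eq_Ioi (zero_le_one' ℝ), integrableOn_union]
  constructor
  · have : IntegrableOn (fun _ : ℝ => (1 : ℝ)) (Set.Ioc 0 1) := by simp
    refine this.mono' hm.aestronglyMeasurable ?_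
    filter_upwards [ae_restrict_mem measurableSet_Ioc] with r hr
    have h0 : 0 ≤ b * r ^ (-γ) := mul_nonneg hb.le (rpow_nonneg hr.1.le _)
    have h1 : exp (-(b * r ^ (-γ))) ≤ 1 := exp_le_one_iff.2 (by linarith)
    have h2 := exp_pos (-(b * r ^ (-γ)))
    rw [norm_eq_abs, abs_of_nonneg (mul_nonneg (by linarith) hr.1.le)]
    exact mul_le_one₀ (by linarith) hr.1.le hr.2
  · have := (integrableOn_Ioi_rpow_of_lt (a := -γ + 1) (by linarith) one_pos).const_mul b
    refine this.mono' hm.aestronglyMeasurable ?_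
    filter_upwards [ae_restrict_mem measurableSet_Ioi] with r hr
    have hr0 : 0 < r := one_pos.trans hr
    have h0 : 0 ≤ b * r ^ (-γ) := mul_nonneg hb.le (rpow_nonneg hr0.le _)
    have h1 : exp (-(b * r ^ (-γ))) ≤ 1 := exp_le_one_iff.2 (by linarith)
    have h2 := add_one_le_exp (-(b * r ^ (-γ)))
    rw [norm_eq_abs, abs_of_nonneg (mul_nonneg (by linarith) hr0.le),
      rpow_add_one hr0.ne', ← mul_assoc]
    exact mul_le_mul_of_nonneg_right (by linarith) hr0.le

lemma aux_ZW (γ b : ℝ) (hγ : 2 < γ) (hb : 0 < b) :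
    ∫ r in Set.Ioi (0 : ℝ), (1 - exp (-(b * r ^ (-γ)))) * r
      = (1 / 2) * (b ^ (2 / γ) * Gamma (1 - 2 / γ)) := by
  have hγ0 : 0 < γ := by linarith
  have h1 := aux_int γ b hγ hb
  have hq : -1 < -(2 / γ) := by
    rw [neg_lt_neg_iff, div_lt_one hγ0]; exact hγ
  obtain ⟨h2, h3⟩ := aux_K γ b (-(2 / γ)) hγ0 hb hq
  have he : -γ - 1 - γ * (-(2 / γ)) = -γ + 1 := by field_simp; ring
  rw [he] at h2 h3
  have h4 := integral_Ioi_of_hasDerivAt_of_tendsto (a := (0 : ℝ)) (m := 0)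
    (f := fun r : ℝ => (1 - exp (-(b * r ^ (-γ)))) * (r ^ 2 / 2))
    (f' := fun r : ℝ => (1 - exp (-(b * r ^ (-γ)))) * r
      - (γ * b / 2) * (r ^ (-γ + 1) * exp (-(b * r ^ (-γ))))) ?_ ?_ (h1.sub (h2.const_mul _)) ?_
  · rw [integral_sub h1 (h2.const_mul _), integral_const_mul, h3] at h4
    simp only [ne_eq, OfNat.ofNat_ne_zero, not_false_eq_true, zero_pow, zero_div, mul_zero,
      sub_zero] at h4
    rw [sub_eq_zero.1 h4]
    have : b ^ (2 / γ) = b * b ^ (-(-(2 / γ) + 1)) := by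
      rw [show 2 / γ = -(-(2 / γ) + 1) + 1 by ring, rpow_add_one hb.ne']; ring_nf
    rw [this, show -(2 / γ) + 1 = 1 - 2 / γ by ring]
    field_simp
  · -- continuity at zero
    have hz : (fun r : ℝ => (1 - exp (-(b * r ^ (-γ)))) * (r ^ 2 / 2)) 0 = 0 := by simp
    unfold ContinuousWithinAt
    rw [hz]
    have hlim : Filter.Tendsto (fun r : ℝ => r ^ 2 / 2) (nhdsWithin 0 (Set.Ici 0)) (nhds 0) := by
      have : Continuous (fun r : ℝ => r ^ 2 / 2) := by fun_prop
      have := this.tendsto 0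
      simp only [ne_eq, OfNat.ofNat_ne_zero, not_false_eq_true, zero_pow, zero_div] at this
      exact this.mono_left nhdsWithin_le_nhds
    refine squeeze_zero' ?_ ?_ hlim
    · filter_upwards [self_mem_nhdsWithin] with r hr
      have h0 : 0 ≤ b * r ^ (-γ) := mul_nonneg hb.le (rpow_nonneg hr _)
      have h1 : exp (-(b * r ^ (-γ))) ≤ 1 := exp_le_one_iff.2 (by linarith)
      exact mul_nonneg (by linarith) (by positivity)
    · filter_upwards [self_mem_nhdsWithin] with r hr
      have h2 := exp_pos (-(b * r ^ (-γ)))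
      exact mul_le_of_le_one_left (by positivity) (by linarith)
  · intro r hr
    have hr : 0 < r := hr
    have d1 : HasDerivAt (fun r : ℝ => r ^ (-γ)) (-γ * r ^ (-γ - 1)) r :=
      hasDerivAt_rpow_const (Or.inl hr.ne')
    have d2 := (((d1.const_mul b).neg.exp).const_sub 1).mul ((hasDerivAt_pow 2 r).div_const 2)
    refine d2.congr_deriv ?_
    have e1 : r ^ (-γ + 1) = r ^ (-γ - 1) * r ^ 2 := by
      rw [← rpow_natCast, ← rpow_add hr]; congr 1; push_cast; ring
    rw [e1]
    simp only [Pi.neg_apply]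
    push_cast
    ring
  · have hlim : Filter.Tendsto (fun r : ℝ => b / 2 * r ^ (-(γ - 2))) Filter.atTop (nhds 0) := by
      simpa using (tendsto_rpow_neg_atTop (y := γ - 2) (by linarith)).const_mul (b / 2)
    refine squeeze_zero' ?_ ?_ hlim
    · filter_upwards [Filter.eventually_gt_atTop 0] with r hr
      have h0 : 0 ≤ b * r ^ (-γ) := mul_nonneg hb.le (rpow_nonneg hr.le _)
      have h1 : exp (-(b * r ^ (-γ))) ≤ 1 := exp_le_one_iff.2 (by linarith)
      exact mul_nonneg (by linarith) (by positivity)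
    · filter_upwards [Filter.eventually_gt_atTop 0] with r hr
      have h2 := add_one_le_exp (-(b * r ^ (-γ)))
      have e1 : r ^ (-(γ - 2)) = r ^ (-γ) * r ^ 2 := by
        rw [← rpow_natCast, ← rpow_add hr]; congr 1; push_cast; ring
      rw [e1]
      calc (1 - exp (-(b * r ^ (-γ)))) * (r ^ 2 / 2) ≤ (b * r ^ (-γ)) * (r ^ 2 / 2) :=
            mul_le_mul_of_nonneg_right (by linarith) (by positivity)
        _ = _ := by ring

/-- Comparison of `Z` with its wideband version. -/
lemma aux_Z (γ a s : ℝ) (hγ : 2 < γ) (ha : 0 < a) (hs : 0 < s) :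
    IntegrableOn (fun r : ℝ => (1 - exp (-(s * (r ^ (-γ - 2) * (γ ^ 2 + a * r ^ 2))))) * r)
      (Set.Ioi 0) ∧
    (1 / 2) * ((s * a) ^ (2 / γ) * Gamma (1 - 2 / γ)) <
      ∫ r in Set.Ioi (0 : ℝ), (1 - exp (-(s * (r ^ (-γ - 2) * (γ ^ 2 + a * r ^ 2))))) * r ∧
    ∫ r in Set.Ioi (0 : ℝ), (1 - exp (-(s * (r ^ (-γ - 2) * (γ ^ 2 + a * r ^ 2))))) * r ≤
      (1 / 2) * ((s * a) ^ (2 / γ) * Gamma (1 - 2 / γ)) + γ / a := by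
  have hγ0 : 0 < γ := by linarith
  have hsa : 0 < s * a := mul_pos hs ha
  have h1 := aux_int γ (s * a) hγ hsa
  have h2 := aux_ZW γ (s * a) hγ hsa
  obtain ⟨h3, h4⟩ := aux_K γ (s * a) 0 hγ0 hsa (by norm_num)
  simp only [mul_zero, sub_zero, zero_add, Gamma_one, mul_one, rpow_neg_one] at h3 h4
  have h5 := h3.const_mul (s * γ ^ 2)
  have hsum : ∫ r in Set.Ioi (0 : ℝ), ((1 - exp (-(s * a * r ^ (-γ)))) * r
      + s * γ ^ 2 * (r ^ (-γ - 1) * exp (-(s * a * r ^ (-γ)))))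
      = (1 / 2) * ((s * a) ^ (2 / γ) * Gamma (1 - 2 / γ)) + γ / a := by
    rw [integral_add h1 h5, h2, integral_const_mul, h4]
    field_simp
  have hexp : ∀ r > 0, exp (-(s * (r ^ (-γ - 2) * (γ ^ 2 + a * r ^ 2))))
      = exp (-(s * a * r ^ (-γ))) * exp (-(s * γ ^ 2 * r ^ (-γ - 2))) := by
    intro r hr
    have e1 : r ^ (-γ) = r ^ (-γ - 2) * r ^ 2 := by
      rw [← rpow_natCast, ← rpow_add hr]; congr 1; push_cast; ring
    rw [← exp_add, e1]; congr 1; ring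
  have hlow : ∀ r > 0, (1 - exp (-(s * a * r ^ (-γ)))) * r <
      (1 - exp (-(s * (r ^ (-γ - 2) * (γ ^ 2 + a * r ^ 2))))) * r := by
    intro r hr
    rw [hexp r hr]
    have p1 : 0 < s * γ ^ 2 * r ^ (-γ - 2) := by positivity
    have p2 : exp (-(s * γ ^ 2 * r ^ (-γ - 2))) < 1 := exp_lt_one_iff.2 (by linarith)
    have p3 := mul_lt_of_lt_one_right (exp_pos (-(s * a * r ^ (-γ)))) p2
    exact mul_lt_mul_of_pos_right (by linarith) hr
  have hup : ∀ r > 0, (1 - exp (-(s * (r ^ (-γ - 2) * (γ ^ 2 + a * r ^ 2))))) * r ≤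
      (1 - exp (-(s * a * r ^ (-γ)))) * r
      + s * γ ^ 2 * (r ^ (-γ - 1) * exp (-(s * a * r ^ (-γ)))) := by
    intro r hr
    rw [hexp r hr]
    have p2 := add_one_le_exp (-(s * γ ^ 2 * r ^ (-γ - 2)))
    have e1 : r ^ (-γ - 1) = r ^ (-γ - 2) * r := by
      rw [← rpow_add_one hr.ne']; congr 1; ring
    rw [e1]
    have p3 := mul_le_mul_of_nonneg_left p2 (mul_pos (exp_pos (-(s * a * r ^ (-γ)))) hr).le
    linarith
  have hZint : IntegrableOn
      (fun r : ℝ => (1 - exp (-(s * (r ^ (-γ - 2) * (γ ^ 2 + a * r ^ 2))))) * r)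
      (Set.Ioi 0) := by
    refine (h1.add h5).mono' (by fun_prop) ?_
    filter_upwards [ae_restrict_mem measurableSet_Ioi] with r hr
    have hr0 : 0 < r := hr
    have p1 : 0 ≤ s * a * r ^ (-γ) := by positivity
    have p2 : exp (-(s * a * r ^ (-γ))) ≤ 1 := exp_le_one_iff.2 (by linarith)
    have p3 : 0 ≤ (1 - exp (-(s * a * r ^ (-γ)))) * r := mul_nonneg (by linarith) hr0.le
    rw [norm_eq_abs, abs_of_nonneg (p3.trans (hlow r hr0).le)]
    exact hup r hr0
  refine ⟨hZint, ?_, ?_⟩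
  · rw [← h2]; exact aux_lt _ _ h1 hZint hlow
  · rw [← hsum]
    exact setIntegral_mono_on hZint (h1.add h5) measurableSet_Ioi hup

/-- With `g(r) = r^{−γ−2}·(γ² + 4·W_e·r²/c²)`, `Z(s) = ∫₀^∞ (1 − exp(−s·g(r)))·r dr`,
`CRB_LB = (4/ρ)·∫₀^∞ exp(−2πλ·Z(s)) ds` and
`CRB_LB,W = (c²/(ρ·W_e))·(πλ)^{−γ/2}·Γ(1 − 2/γ)^{−γ/2}·Γ(1 + γ/2)`, the quantity
`CRB_LB` is finite and `(1 − πλ·c²·γ/(2·W_e))·CRB_LB,W < CRB_LB < CRB_LB,W`. -/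
theorem CRB_LB_wideband_sandwich (γ We c lam ρ : ℝ)
    (hγ : 2 < γ) (hWe : 0 < We) (hc : 0 < c) (hlam : 0 < lam) (hρ : 0 < ρ)
    (g Z : ℝ → ℝ)
    (hg : ∀ r > 0, g r = r ^ (-γ - 2) * (γ ^ 2 + 4 * We * r ^ 2 / c ^ 2))
    (hZ : ∀ s > 0, Z s = ∫ r in Set.Ioi (0 : ℝ), (1 - Real.exp (-s * g r)) * r)
    (CRB_LB CRB_LBW : ℝ)
    (hLB : CRB_LB = (4 / ρ) * ∫ s in Set.Ioi (0 : ℝ), Real.exp (-(2 * π * lam * Z s)))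
    (hLBW : CRB_LBW = c ^ 2 / (ρ * We) * (π * lam) ^ (-(γ / 2))
          * Real.Gamma (1 - 2 / γ) ^ (-(γ / 2)) * Real.Gamma (1 + γ / 2)) :
    IntegrableOn (fun s : ℝ => Real.exp (-(2 * π * lam * Z s))) (Set.Ioi 0) ∧
    (1 - π * lam * c ^ 2 * γ / (2 * We)) * CRB_LBW < CRB_LB ∧ CRB_LB < CRB_LBW := by
  have hγ0 : 0 < γ := by linarith
  have ha : 0 < 4 * We / c ^ 2 := by positivity
  set a := 4 * We / c ^ 2 with ha_def
  have hZ' : ∀ s > 0, Z s = ∫ r in Set.Ioi (0 : ℝ),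
      (1 - exp (-(s * (r ^ (-γ - 2) * (γ ^ 2 + a * r ^ 2))))) * r := by
    intro s hs
    rw [hZ s hs]
    refine setIntegral_congr_fun measurableSet_Ioi (fun r hr => ?_)
    rw [hg r hr, show 4 * We * r ^ 2 / c ^ 2 = a * r ^ 2 by rw [ha_def]; ring, neg_mul]
  have hG : 0 < Gamma (1 - 2 / γ) := Gamma_pos_of_pos (by
    rw [sub_pos, div_lt_one hγ0]; exact hγ)
  set G := Gamma (1 - 2 / γ) with hG_def
  have hk : 0 < π * lam * G * a ^ (2 / γ) := by positivity
  set k := π * lam * G * a ^ (2 / γ) with hk_def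
  have hp : 0 < 2 / γ := by positivity
  have hZW : ∀ s > 0, 2 * π * lam * ((1 / 2) * ((s * a) ^ (2 / γ) * G)) = k * s ^ (2 / γ) := by
    intro s hs
    rw [mul_rpow hs.le ha.le, hk_def]; ring
  have hx : 0 < 2 * π * lam * (γ / a) := by positivity
  have hlo : ∀ s > 0, exp (-(2 * π * lam * Z s)) < exp (-k * s ^ (2 / γ)) := by
    intro s hs
    have h := (aux_Z γ a s hγ ha hs).2.1
    rw [← hZ' s hs] at h
    have h' := mul_lt_mul_of_pos_left h (show 0 < 2 * π * lam by positivity)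
    rw [hZW s hs] at h'
    exact exp_lt_exp.2 (by linarith)
  have hhi : ∀ s > 0, exp (-(2 * π * lam * (γ / a))) * exp (-k * s ^ (2 / γ)) ≤
      exp (-(2 * π * lam * Z s)) := by
    intro s hs
    have h := (aux_Z γ a s hγ ha hs).2.2
    rw [← hZ' s hs] at h
    have h' := mul_le_mul_of_nonneg_left h (show 0 ≤ 2 * π * lam by positivity)
    rw [mul_add, hZW s hs] at h'
    rw [← exp_add]
    exact exp_le_exp.2 (by linarith)
  have hanti : AntitoneOn (fun s : ℝ => exp (-(2 * π * lam * Z s))) (Set.Ioi 0) := by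
    intro s hs t ht hst
    have hs : 0 < s := hs
    have ht : 0 < t := ht
    have h : Z s ≤ Z t := by
      rw [hZ' s hs, hZ' t ht]
      refine setIntegral_mono_on (aux_Z γ a s hγ ha hs).1 (aux_Z γ a t hγ ha ht).1
        measurableSet_Ioi (fun r hr => ?_)
      have hr : 0 < r := hr
      refine mul_le_mul_of_nonneg_right ?_ hr.le
      have : s * (r ^ (-γ - 2) * (γ ^ 2 + a * r ^ 2)) ≤
          t * (r ^ (-γ - 2) * (γ ^ 2 + a * r ^ 2)) :=
        mul_le_mul_of_nonneg_right hst (by positivity)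
      have := exp_le_exp.2 (neg_le_neg this)
      linarith
    have h' := mul_le_mul_of_nonneg_left h (show 0 ≤ 2 * π * lam by positivity)
    exact exp_le_exp.2 (neg_le_neg h')
  have hWint : IntegrableOn (fun s : ℝ => exp (-k * s ^ (2 / γ))) (Set.Ioi 0) := by
    simpa using integrableOn_rpow_mul_exp_neg_mul_rpow (s := 0) (by norm_num) hp hk
  have hZint : IntegrableOn (fun s : ℝ => exp (-(2 * π * lam * Z s))) (Set.Ioi 0) := by
    refine hWint.mono' (aemeasurable_restrict_of_antitoneOn measurableSet_Ioi
      hanti).aestronglyMeasurable ?_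
    filter_upwards [ae_restrict_mem measurableSet_Ioi] with s hs
    rw [norm_eq_abs, abs_of_pos (exp_pos _)]
    exact (hlo s hs).le
  have hWval := integral_exp_neg_mul_rpow hp hk
  have hLBW' : CRB_LBW = (4 / ρ) * ∫ s in Set.Ioi (0 : ℝ), exp (-k * s ^ (2 / γ)) := by
    rw [hWval, hLBW, show -1 / (2 / γ) = -(γ / 2) by field_simp,
      show 1 / (2 / γ) + 1 = 1 + γ / 2 by field_simp; ring, hk_def,
      mul_rpow (x := π * lam * G) (by positivity) (by positivity),
      mul_rpow (x := π * lam) (y := G) (by positivity) hG.le,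
      ← rpow_mul ha.le, show 2 / γ * -(γ / 2) = -1 by field_simp, rpow_neg_one, ha_def]
    field_simp
  have hIpos : 0 < ∫ s in Set.Ioi (0 : ℝ), exp (-k * s ^ (2 / γ)) := by
    rw [hWval]
    exact mul_pos (rpow_pos_of_pos hk _) (Gamma_pos_of_pos (by positivity))
  have hρ4 : 0 < 4 / ρ := by positivity
  refine ⟨hZint, ?_, ?_⟩
  · have hc1 : π * lam * c ^ 2 * γ / (2 * We) = 2 * π * lam * (γ / a) := by
      rw [ha_def]; field_simp; ring
    have h1 : exp (-(2 * π * lam * (γ / a))) * ∫ s in Set.Ioi (0 : ℝ), exp (-k * s ^ (2 / γ)) ≤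
        ∫ s in Set.Ioi (0 : ℝ), exp (-(2 * π * lam * Z s)) := by
      rw [← integral_const_mul]
      exact setIntegral_mono_on (hWint.const_mul _) hZint measurableSet_Ioi hhi
    have h2 := add_one_lt_exp (neg_ne_zero.2 hx.ne')
    have h3 := mul_lt_mul_of_pos_right h2 hIpos
    rw [hc1, hLBW', hLB, mul_left_comm]
    refine mul_lt_mul_of_pos_left ?_ hρ4
    linarith
  · rw [hLBW', hLB]
    exact mul_lt_mul_of_pos_left (aux_lt _ _ hZint hWint hlo) hρ4
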